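/- Let A be a ring and let X, Y be bounded nonnegatively graded chain complexes of A[t]-modules each of whose terms is finitely generated projective as an A-module. Let f : X → Y be an A[t]-linear chain map which is m-connected, i.e. H_q(cone f) = 0 for all q ≤ m. Then there exist an integer n ≥ m, chain complexes Z_m = X, Z_{m+1}, …, Z_n of A[t]-modules each of whose terms is finitely generated projective as an A-module, A[t]-linear chain maps Z_{q−1} → Z_q for m < q ≤ n, and an A[t]-linear chain map Z_n → Y, such that the composite equals f, the map Z_n → Y is a quasi-isomorphism, and for each q with m < q ≤ n the homology of cone(Z_{q−1} → Z_q) vanishes in all degrees except q, where it is finitely generated projective as an A-module. -/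

import Mathlib

open CategoryTheory Limits

universe u

instance instDecRelDownInt : DecidableRel (ComplexShape.down ℤ).Rel :=
  fun a b => inferInstanceAs (Decidable (b + 1 = a))

instance instHasCofiber {A : Type u} [Ring A] {X Y : ChainComplex (ModuleCat.{u} A) ℤ}
    (f : X ⟶ Y) : HomologicalComplex.HasHomotopyCofiber f :=
  @HomologicalComplex.instHasHomotopyCofiberOfHasBinaryBiproducts _ _ _ _ _ _ _ _ inferInstance

/-- The mapping cone of a chain map: in degree `q` it is `Y_q ⊕ X_{q−1}`. -/
noncomputable def Cone {A : Type u} [Ring A] {X Y : ChainComplex (ModuleCat.{u} A) ℤ}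
    (f : X ⟶ Y) : ChainComplex (ModuleCat.{u} A) ℤ :=
  HomologicalComplex.homotopyCofiber f

/-- The composite `Z 0 ⟶ Z N` of a chain of maps `Z j ⟶ Z (j+1)`. -/
noncomputable def compChain {A : Type u} [Ring A]
    (Z : ℕ → ChainComplex (ModuleCat.{u} A) ℤ) (φ : ∀ j, Z j ⟶ Z (j + 1)) :
    ∀ N, Z 0 ⟶ Z N
  | 0 => 𝟙 _
  | (N + 1) => compChain Z φ N ≫ φ N

/-- A module over `A[t]` is finitely generated projective as an `A`-module (restriction of
scalars along `A → A[t]`). -/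
def FGProjOverA (A : Type u) [Ring A] (M : ModuleCat.{u} (Polynomial A)) : Prop :=
  Module.Finite A ((ModuleCat.restrictScalars.{u} (Polynomial.C : A →+* Polynomial A)).obj M) ∧
  Module.Projective A ((ModuleCat.restrictScalars.{u} (Polynomial.C : A →+* Polynomial A)).obj M)

namespace Aux

section FG
variable {A : Type u} [Ring A]

lemma fg_of_zero {M : ModuleCat.{u} (Polynomial A)} (h : ∀ x : M, x = 0) : FGProjOverA A M := by
  have : Subsingleton ((ModuleCat.restrictScalars.{u} (Polynomial.C : A →+* Polynomial A)).obj M) :=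
    ⟨fun a b => (h a).trans (h b).symm⟩
  exact ⟨inferInstance, inferInstance⟩

lemma fg_prod {M N P : ModuleCat.{u} (Polynomial A)} (hM : FGProjOverA A M)
    (hN : FGProjOverA A N) (e : P ≃ₗ[Polynomial A] (M × N)) : FGProjOverA A P := by
  let F := ModuleCat.restrictScalars.{u} (Polynomial.C : A →+* Polynomial A)
  obtain ⟨h1, h2⟩ := hM
  obtain ⟨h3, h4⟩ := hN
  let e' : (F.obj M × F.obj N) ≃ₗ[A] F.obj P :=
    { toFun := fun x => e.symm x
      invFun := fun x => e x
      left_inv := fun x => e.apply_symm_apply x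
      right_inv := fun x => e.symm_apply_apply x
      map_add' := fun x y => e.symm.map_add x y
      map_smul' := fun a x => e.symm.map_smul (Polynomial.C a) x }
  exact ⟨Module.Finite.equiv e', Module.Projective.of_equiv e'⟩

lemma fg_equiv {M P : ModuleCat.{u} (Polynomial A)} (hM : FGProjOverA A M)
    (e : P ≃ₗ[Polynomial A] M) : FGProjOverA A P := by
  let F := ModuleCat.restrictScalars.{u} (Polynomial.C : A →+* Polynomial A)
  obtain ⟨h1, h2⟩ := hM
  let e' : (F.obj M) ≃ₗ[A] F.obj P :=
    { toFun := fun x => e.symm x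
      invFun := fun x => e x
      left_inv := fun x => e.apply_symm_apply x
      right_inv := fun x => e.symm_apply_apply x
      map_add' := fun x y => e.symm.map_add x y
      map_smul' := fun a x => e.symm.map_smul (Polynomial.C a) x }
  exact ⟨Module.Finite.equiv e', Module.Projective.of_equiv e'⟩

lemma fg_ker {K M N : ModuleCat.{u} (Polynomial A)} (hM : FGProjOverA A M)
    (hN : FGProjOverA A N) (i : K ⟶ M) (p : M ⟶ N) (hi : Function.Injective i)
    (hp : Function.Surjective p) (hex : Function.Exact i p) : FGProjOverA A K := by
  let F := ModuleCat.restrictScalars.{u} (Polynomial.C : A →+* Polynomial A)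
  obtain ⟨h1, h2⟩ := hM
  obtain ⟨h3, h4⟩ := hN
  let i' : F.obj K →ₗ[A] F.obj M := (F.map i).hom
  let p' : F.obj M →ₗ[A] F.obj N := (F.map p).hom
  have hi' : Function.Injective i' := hi
  have hp' : Function.Surjective p' := hp
  have hex' : Function.Exact i' p' := hex
  obtain ⟨s, hs⟩ := Module.projective_lifting_property p' LinearMap.id hp'
  obtain ⟨e, he, -⟩ := hex'.splitSurjectiveEquiv hi' ⟨s, hs⟩
  let r : F.obj M →ₗ[A] F.obj K := LinearMap.fst A _ _ ∘ₗ e.toLinearMap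
  have hr : r ∘ₗ i' = LinearMap.id := by
    rw [he]; ext x; simp [r]
  refine ⟨Module.Finite.of_surjective r fun x => ⟨i' x, LinearMap.congr_fun hr x⟩,
    Module.Projective.of_split i' r hr⟩

end FG

section Cx
variable {R : Type u} [Ring R]

lemma dd (K : ChainComplex (ModuleCat.{u} R) ℤ) (i j k : ℤ) (x : K.X i) :
    K.d j k (K.d i j x) = 0 := by
  have := ConcreteCategory.congr_hom (K.d_comp_d i j k) x
  exact this

lemma comm {K L : ChainComplex (ModuleCat.{u} R) ℤ} (φ : K ⟶ L) (i j : ℤ) (x : K.X i) :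
    L.d i j (φ.f i x) = φ.f j (K.d i j x) := by
  have := ConcreteCategory.congr_hom (φ.comm i j) x
  exact this

lemma exact_iff (K : ChainComplex (ModuleCat.{u} R) ℤ) (i : ℤ) :
    IsZero (K.homology i) ↔
      ∀ x : K.X i, K.d i (i - 1) x = 0 → ∃ y : K.X (i + 1), K.d (i + 1) i y = x := by
  rw [← HomologicalComplex.exactAt_iff_isZero_homology,
    HomologicalComplex.exactAt_iff' K (i + 1) i (i - 1) (by simp) (by simp),
    ShortComplex.moduleCat_exact_iff]
  rfl

lemma cyc_lift (K : ChainComplex (ModuleCat.{u} R) ℤ) (i : ℤ) (x : K.X i)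
    (hx : K.d i (i - 1) x = 0) : ∃ z : K.cycles i, K.iCycles i z = x := by
  let S := ShortComplex.mk (K.iCycles i) (K.d i (i - 1)) (K.iCycles_d i (i-1))
  have hS : S.Exact := S.exact_of_f_is_kernel (K.cyclesIsKernel i (i-1) (by simp))
  exact (ShortComplex.moduleCat_exact_iff S).1 hS x hx

lemma iCyc_inj (K : ChainComplex (ModuleCat.{u} R) ℤ) (i : ℤ) :
    Function.Injective (K.iCycles i) := (ModuleCat.mono_iff_injective _).1 inferInstance

lemma hom_rep (K : ChainComplex (ModuleCat.{u} R) ℤ) (i : ℤ) (w : K.homology i) :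
    ∃ z : K.cycles i, K.homologyπ i z = w :=
  (ModuleCat.epi_iff_surjective (K.homologyπ i)).1 inferInstance w

lemma iCyc_d (K : ChainComplex (ModuleCat.{u} R) ℤ) (i j : ℤ) (z : K.cycles i) :
    K.d i j (K.iCycles i z) = 0 := by
  have := ConcreteCategory.congr_hom (K.iCycles_d i j) z
  exact this

lemma π_zero_iff (K : ChainComplex (ModuleCat.{u} R) ℤ) (i : ℤ) (z : K.cycles i) :
    K.homologyπ i z = 0 ↔ ∃ y : K.X (i + 1), K.d (i + 1) i y = K.iCycles i z := by
  let S := ShortComplex.mk (K.toCycles (i + 1) i) (K.homologyπ i) (by simp)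
  have hS : S.Exact := S.exact_of_g_is_cokernel (K.homologyIsCokernel (i + 1) i (by simp))
  have key : ∀ y, K.iCycles i (K.toCycles (i + 1) i y) = K.d (i + 1) i y := fun y => by
    have := ConcreteCategory.congr_hom (K.toCycles_i (i+1) i) y
    exact this
  constructor
  · intro h
    obtain ⟨y, hy⟩ := (ShortComplex.moduleCat_exact_iff S).1 hS z h
    refine ⟨y, ?_⟩
    rw [← key]; exact congrArg _ hy
  · rintro ⟨y, hy⟩
    rw [← key] at hy
    rw [← iCyc_inj K i hy]
    exact ShortComplex.moduleCat_zero_apply S y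

lemma quasi {K L : ChainComplex (ModuleCat.{u} R) ℤ} (φ : K ⟶ L)
    (hinj : ∀ i (z : K.X i) (y : L.X (i + 1)), K.d i (i - 1) z = 0 → L.d (i + 1) i y = φ.f i z →
      ∃ z' : K.X (i + 1), K.d (i + 1) i z' = z)
    (hsurj : ∀ i (y : L.X i), L.d i (i - 1) y = 0 →
      ∃ (z : K.X i) (y' : L.X (i + 1)), K.d i (i - 1) z = 0 ∧ φ.f i z = y + L.d (i + 1) i y') :
    QuasiIso φ := by
  rw [quasiIso_iff]
  intro i
  rw [quasiIsoAt_iff_isIso_homologyMap]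
  have h1 : ∀ z, L.iCycles i (HomologicalComplex.cyclesMap φ i z) = φ.f i (K.iCycles i z) :=
    fun z => by
      have := ConcreteCategory.congr_hom (HomologicalComplex.cyclesMap_i φ i) z
      exact this
  have h2 : ∀ z, HomologicalComplex.homologyMap φ i (K.homologyπ i z) =
      L.homologyπ i (HomologicalComplex.cyclesMap φ i z) :=
    fun z => by
      have := ConcreteCategory.congr_hom (HomologicalComplex.homologyπ_naturality φ i) z
      exact this
  rw [ConcreteCategory.isIso_iff_bijective]
  constructor
  · rw [injective_iff_map_eq_zero]
    intro w hw
    obtain ⟨z, rfl⟩ := hom_rep K i w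
    rw [h2, π_zero_iff] at hw
    obtain ⟨y, hy⟩ := hw
    rw [h1] at hy
    rw [π_zero_iff]
    exact hinj i _ y (iCyc_d K i _ z) hy
  · intro w
    obtain ⟨v, rfl⟩ := hom_rep L i w
    obtain ⟨z, y', hz, hy⟩ := hsurj i _ (iCyc_d L i _ v)
    obtain ⟨z, rfl⟩ := cyc_lift K i z hz
    refine ⟨K.homologyπ i z, ?_⟩
    rw [h2, ← sub_eq_zero, ← map_sub, π_zero_iff]
    refine ⟨y', ?_⟩
    rw [map_sub, h1, hy]; abel

/-- identify homology -/
lemma homEquiv (K : ChainComplex (ModuleCat.{u} R) ℤ) (i : ℤ) {M : ModuleCat.{u} R}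
    (π : K.X i ⟶ M) (h0 : ∀ y : K.X (i + 1), π (K.d (i + 1) i y) = 0)
    (hs : ∀ a : M, ∃ x : K.X i, K.d i (i - 1) x = 0 ∧ π x = a)
    (hk : ∀ x : K.X i, K.d i (i - 1) x = 0 → π x = 0 → ∃ y, K.d (i + 1) i y = x) :
    Nonempty (K.homology i ≃ₗ[R] M) := by
  let h : K.homology i ⟶ M := K.homologyι i ≫ K.descOpcycles π (i + 1) (by simp)
    (by ext y; simpa using h0 y)
  have e : ∀ z, h (K.homologyπ i z) = π (K.iCycles i z) := fun z => by
    have : K.homologyπ i ≫ h = K.iCycles i ≫ π := by simp [h]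
    have := ConcreteCategory.congr_hom this z
    exact this
  have : IsIso h := by
    rw [ConcreteCategory.isIso_iff_bijective]
    constructor
    · rw [injective_iff_map_eq_zero]
      intro w hw
      obtain ⟨z, rfl⟩ := hom_rep K i w
      rw [e] at hw
      rw [π_zero_iff]
      exact hk _ (iCyc_d K i _ z) hw
    · intro a
      obtain ⟨x, hx, rfl⟩ := hs a
      obtain ⟨z, rfl⟩ := cyc_lift K i x hx
      exact ⟨_, e z⟩
  exact ⟨(asIso h).toLinearEquiv⟩

end Cx

section Cn
variable {R : Type u} [Ring R] {X Y : ChainComplex (ModuleCat.{u} R) ℤ} (f : X ⟶ Y)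

open HomologicalComplex in
/-- first projection -/
noncomputable def cfst (i j : ℤ) (h : j + 1 = i) : (Cone f).X i ⟶ X.X j :=
  homotopyCofiber.fstX f i j h

open HomologicalComplex in
/-- second projection -/
noncomputable def csnd (i : ℤ) : (Cone f).X i ⟶ Y.X i :=
  homotopyCofiber.sndX f i

open HomologicalComplex in
/-- element of the cone -/
noncomputable def cmk (i j : ℤ) (h : j + 1 = i) (a : X.X j) (b : Y.X i) : (Cone f).X i :=
  (homotopyCofiber.inlX f j i h a : (Cone f).X i) + (homotopyCofiber.inrX f i b : (Cone f).X i)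

open HomologicalComplex in
lemma cfst_mk (i j : ℤ) (h : j + 1 = i) (a : X.X j) (b : Y.X i) :
    cfst f i j h (cmk f i j h a b) = a := by
  have h1 := ConcreteCategory.congr_hom (homotopyCofiber.inlX_fstX f j i h) a
  have h2 := ConcreteCategory.congr_hom (homotopyCofiber.inrX_fstX f i j h) b
  refine (map_add (cfst f i j h).hom _ _).trans ((congrArg₂ (· + ·) h1 h2).trans ?_)
  exact add_zero a

open HomologicalComplex in
lemma csnd_mk (i j : ℤ) (h : j + 1 = i) (a : X.X j) (b : Y.X i) :
    csnd f i (cmk f i j h a b) = b := by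
  have h1 := ConcreteCategory.congr_hom (homotopyCofiber.inlX_sndX f j i h) a
  have h2 := ConcreteCategory.congr_hom (homotopyCofiber.inrX_sndX f i) b
  refine (map_add (csnd f i).hom _ _).trans ((congrArg₂ (· + ·) h1 h2).trans ?_)
  exact zero_add b

open HomologicalComplex in
lemma mk_eta (i j : ℤ) (h : j + 1 = i) (c : (Cone f).X i) :
    cmk f i j h (cfst f i j h c) (csnd f i c) = c := by
  have h' : (ComplexShape.down ℤ).Rel i j := h
  have : homotopyCofiber.fstX f i j h' ≫ homotopyCofiber.inlX f j i h' +
    homotopyCofiber.sndX f i ≫ homotopyCofiber.inrX f i = 𝟙 _ := by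
    apply homotopyCofiber.ext_to_X f i j h' <;> simp
  exact ConcreteCategory.congr_hom this c

lemma cext (i j : ℤ) (h : j + 1 = i) (c c' : (Cone f).X i)
    (h1 : cfst f i j h c = cfst f i j h c') (h2 : csnd f i c = csnd f i c') : c = c' := by
  rw [← mk_eta f i j h c, h1, h2, mk_eta]

open HomologicalComplex in
lemma cfst_d (i j k : ℤ) (h : j + 1 = i) (h' : k + 1 = j) (c : (Cone f).X i) :
    cfst f j k h' ((Cone f).d i j c) = - X.d j k (cfst f i j h c) :=
  ConcreteCategory.congr_hom (homotopyCofiber.d_fstX f i j k h h') c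

open HomologicalComplex in
lemma csnd_d (i j : ℤ) (h : j + 1 = i) (c : (Cone f).X i) :
    csnd f j ((Cone f).d i j c) = f.f j (cfst f i j h c) + Y.d i j (csnd f i c) :=
  ConcreteCategory.congr_hom (homotopyCofiber.d_sndX f i j h) c

/-- termwise description of the cone -/
noncomputable def cequiv (i j : ℤ) (h : j + 1 = i) : (Cone f).X i ≃ₗ[R] (X.X j × Y.X i) :=
  LinearEquiv.ofBijective ((cfst f i j h).hom.prod (csnd f i).hom) ⟨fun c c' hc =>
      cext f i j h c c' (congrArg Prod.fst hc) (congrArg Prod.snd hc),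
    fun p => ⟨cmk f i j h p.1 p.2, Prod.ext (cfst_mk f i j h _ _) (csnd_mk f i j h _ _)⟩⟩

/-- The cone of an injection that is bijective outside degree `q`. -/
lemma cone_zero (q i : ℤ) (hiq : i ≠ q) (hinj : ∀ i, Function.Injective (f.f i))
    (hsurj : ∀ i, i ≠ q → Function.Surjective (f.f i)) : IsZero ((Cone f).homology i) := by
  rw [exact_iff]
  intro c hc
  obtain ⟨a, ha⟩ := hsurj i hiq (csnd f i c)
  refine ⟨cmk f (i+1) i rfl a 0, ?_⟩
  have h2 := csnd_d f i (i - 1) (by ring) c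
  rw [hc, map_zero, ← ha, comm, ← map_add] at h2
  have h3 := hinj _ (h2.symm.trans (map_zero _).symm)
  apply cext f i (i - 1) (by ring)
  · rw [cfst_d f (i+1) i (i-1) rfl (by ring), cfst_mk]
    exact (eq_neg_of_add_eq_zero_left h3).symm
  · rw [csnd_d f (i+1) i rfl, cfst_mk, csnd_mk, ha]; simp

lemma cone_q (q : ℤ) (hinj : ∀ i, Function.Injective (f.f i))
    (hsurj : ∀ i, i ≠ q → Function.Surjective (f.f i)) {M : ModuleCat.{u} R}
    (p : Y.X q ⟶ M) (hp : Function.Surjective p) (hex : ∀ y, p y = 0 ↔ ∃ x, f.f q x = y) :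
    Nonempty ((Cone f).homology q ≃ₗ[R] M) := by
  refine homEquiv (Cone f) q (csnd f q ≫ p) ?_ ?_ ?_
  · intro y
    obtain ⟨b, hb⟩ := hsurj (q + 1) (by omega) (csnd f _ y)
    change p (csnd f q _) = 0
    rw [csnd_d f (q+1) q rfl, ← hb, comm, ← map_add, hex]
    exact ⟨_, rfl⟩
  · intro a
    obtain ⟨y, rfl⟩ := hp a
    obtain ⟨x, hx⟩ := hsurj (q - 1) (by omega) (Y.d q (q - 1) y)
    refine ⟨cmk f q (q - 1) (by ring) (-x) y, ?_, ?_⟩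
    · apply cext f (q-1) (q-1-1) (by ring)
      · rw [cfst_d f q (q-1) _ (by ring), cfst_mk, map_neg, neg_neg, map_zero]
        apply hinj
        rw [← comm, hx, dd, map_zero]
      · rw [csnd_d f q (q-1) (by ring), cfst_mk, csnd_mk, map_neg, hx, map_zero]; simp
    · change p (csnd f q _) = _
      rw [csnd_mk]
  · intro c hc h0
    obtain ⟨a, ha⟩ := (hex (csnd f q c)).1 h0
    refine ⟨cmk f (q+1) q rfl a 0, ?_⟩
    have h2 := csnd_d f q (q - 1) (by ring) c
    rw [hc, map_zero, ← ha, comm, ← map_add] at h2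
    have h3 := hinj _ (h2.symm.trans (map_zero _).symm)
    apply cext f q (q - 1) (by ring)
    · rw [cfst_d f (q+1) q (q-1) rfl (by ring), cfst_mk]
      exact (eq_neg_of_add_eq_zero_left h3).symm
    · rw [csnd_d f (q+1) q rfl, cfst_mk, csnd_mk, ha]; simp

end Cn

section Wd
variable {R : Type u} [Ring R] {X Y : ChainComplex (ModuleCat.{u} R) ℤ} (f : X ⟶ Y) (m : ℤ)

/-- The brutal truncation (degrees `≤ n`) of the good truncation (degrees `≥ m+1`) of the cone. -/
noncomputable def S (n i : ℤ) : Submodule R ((Cone f).X i) where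
  carrier := {c | (i ≤ m ∨ n < i → c = 0) ∧ (i ≤ m + 1 → (Cone f).d i (i - 1) c = 0)}
  zero_mem' := by simp
  add_mem' := by
    rintro a b ⟨h1, h2⟩ ⟨h3, h4⟩
    refine ⟨fun h => by rw [h1 h, h3 h, add_zero], fun h => by rw [map_add, h2 h, h4 h, add_zero]⟩
  smul_mem' := by
    rintro r a ⟨h1, h2⟩
    refine ⟨fun h => by rw [h1 h, smul_zero], fun h => by rw [map_smul, h2 h, smul_zero]⟩

lemma mem_S {n i : ℤ} {c : (Cone f).X i} : c ∈ S f m n i ↔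
    (i ≤ m ∨ n < i → c = 0) ∧ (i ≤ m + 1 → (Cone f).d i (i - 1) c = 0) := Iff.rfl

lemma S_d (n i j : ℤ) (c : (Cone f).X i) (hc : c ∈ S f m n i) : (Cone f).d i j c ∈ S f m n j := by
  obtain ⟨h1, h2⟩ := hc
  refine ⟨fun h => ?_, fun _ => dd _ _ _ _ _⟩
  by_cases hij : j + 1 = i
  · obtain rfl : j = i - 1 := by omega
    rcases h with h | h
    · exact h2 (by omega)
    · rw [h1 (by omega), map_zero]
  · rw [(Cone f).shape i j hij]; rfl

/-- projection extended by zero -/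
noncomputable def pr (i j : ℤ) : (Cone f).X i →ₗ[R] X.X j :=
  if h : j + 1 = i then (cfst f i j h).hom else 0

lemma pr_eq (i j : ℤ) (h : j + 1 = i) (c : (Cone f).X i) : pr f i j c = cfst f i j h c := by
  rw [pr, dif_pos h]

/-- The differential of `W`. -/
noncomputable def Wd (n i j : ℤ) : (X.X i × S f m n i) →ₗ[R] (X.X j × S f m n j) :=
  LinearMap.prod ((X.d i j).hom ∘ₗ LinearMap.fst R _ _ +
      pr f i j ∘ₗ (S f m n i).subtype ∘ₗ LinearMap.snd R _ _)
    (((Cone f).d i j).hom.restrict (S_d f m n i j) ∘ₗ LinearMap.snd R _ _)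

/-- The complex `X ⊕ S n` inside the mapping cylinder of `f`. -/
noncomputable def W (n : ℤ) : ChainComplex (ModuleCat.{u} R) ℤ where
  X i := ModuleCat.of R (X.X i × S f m n i)
  d i j := ModuleCat.ofHom (Wd f m n i j)
  shape i j hij := by
    refine ModuleCat.hom_ext (LinearMap.ext fun x => ?_)
    have h1 : X.d i j = 0 := X.shape i j hij
    have h2 : (Cone f).d i j = 0 := (Cone f).shape i j hij
    have h3 : pr f i j = 0 := dif_neg hij
    refine Prod.ext ?_ (Subtype.ext ?_)
    · change X.d i j x.1 + pr f i j x.2 = 0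
      rw [h1, h3]; exact add_zero _
    · change (Cone f).d i j x.2 = 0
      rw [h2]; rfl
  d_comp_d' i j k hij hjk := by
    refine ModuleCat.hom_ext (LinearMap.ext fun x => ?_)
    refine Prod.ext ?_ (Subtype.ext ?_)
    · change X.d j k (X.d i j x.1 + pr f i j x.2) + pr f j k ((Cone f).d i j x.2) = 0
      rw [pr_eq f i j hij, pr_eq f j k hjk, cfst_d f i j k hij hjk, map_add, dd]
      simp
    · exact dd _ _ _ _ _

lemma Wd_fst (n i j : ℤ) (h : j + 1 = i) (x : X.X i) (c : S f m n i) :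
    ((W f m n).d i j (x, c)).1 = X.d i j x + cfst f i j h c := by
  rw [← pr_eq]; rfl

lemma Wd_snd (n i j : ℤ) (x : X.X i) (c : S f m n i) :
    (((W f m n).d i j (x, c)).2 : (Cone f).X j) = (Cone f).d i j c := rfl

lemma W_ext {n i : ℤ} (w w' : (W f m n).X i) (h1 : w.1 = w'.1)
    (h2 : (w.2 : (Cone f).X i) = w'.2) : w = w' := Prod.ext h1 (Subtype.ext h2)

/-- inclusion of `X` -/
noncomputable def inc (n : ℤ) : X ⟶ W f m n where
  f i := ModuleCat.ofHom (LinearMap.inl R (X.X i) (S f m n i))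
  comm' i j hij := by
    refine ModuleCat.hom_ext (LinearMap.ext fun x => ?_)
    refine W_ext f m _ _ ?_ ?_
    · refine (Wd_fst f m n i j hij _ _).trans ?_
      change X.d i j x + cfst f i j hij 0 = X.d i j x
      simp
    · exact map_zero ((Cone f).d i j).hom

lemma S_mono {n n' : ℤ} (h : n ≤ n') (i : ℤ) : S f m n i ≤ S f m n' i := by
  rintro c ⟨h1, h2⟩
  exact ⟨fun h' => h1 (by omega), h2⟩

/-- transition maps -/
noncomputable def tr {n n' : ℤ} (h : n ≤ n') : W f m n ⟶ W f m n' where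
  f i := ModuleCat.ofHom (LinearMap.prodMap LinearMap.id (Submodule.inclusion (S_mono f m h i)))
  comm' i j hij := by
    refine ModuleCat.hom_ext (LinearMap.ext fun x => ?_)
    rfl

/-- map to `Y` -/
noncomputable def toY (n : ℤ) : W f m n ⟶ Y where
  f i := ModuleCat.ofHom ((f.f i).hom ∘ₗ LinearMap.fst R _ _ -
      (csnd f i).hom ∘ₗ (S f m n i).subtype ∘ₗ LinearMap.snd R _ _)
  comm' i j hij := by
    refine ModuleCat.hom_ext (LinearMap.ext fun x => ?_)
    change Y.d i j (f.f i x.1 - csnd f i x.2) = f.f j ((W f m n).d i j (x.1, x.2)).1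
      - csnd f j ((W f m n).d i j (x.1, x.2)).2
    rw [Wd_fst f m n i j hij, Wd_snd, csnd_d f i j hij, map_add, map_sub, comm]
    abel

lemma toY_apply (n i : ℤ) (x : X.X i) (c : S f m n i) :
    (toY f m n).f i (x, c) = f.f i x - csnd f i c := rfl

lemma inc_tr {n n' : ℤ} (h : n ≤ n') : inc f m n ≫ tr f m h = inc f m n' := by
  refine HomologicalComplex.hom_ext _ _ fun i => ModuleCat.hom_ext (LinearMap.ext fun x => ?_)
  rfl

lemma tr_tr {n n' n'' : ℤ} (h : n ≤ n') (h' : n' ≤ n'') :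
    tr f m h ≫ tr f m h' = tr f m (h.trans h') := by
  refine HomologicalComplex.hom_ext _ _ fun i => ModuleCat.hom_ext (LinearMap.ext fun x => ?_)
  rfl

lemma inc_toY (n : ℤ) : inc f m n ≫ toY f m n = f := by
  refine HomologicalComplex.hom_ext _ _ fun i => ModuleCat.hom_ext (LinearMap.ext fun x => ?_)
  change f.f i x - csnd f i 0 = f.f i x
  simp

lemma toY_quasi (n : ℤ) (hn : ∀ i, n < i → ∀ c : (Cone f).X i, c = 0)
    (hconn : ∀ q : ℤ, q ≤ m → IsZero ((Cone f).homology q)) : QuasiIso (toY f m n) := by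
  apply quasi
  · rintro i ⟨x, c⟩ y hz hy
    have hx := congrArg Prod.fst hz
    rw [Wd_fst f m n i (i-1) (by ring)] at hx
    change _ = (0 : X.X (i - 1)) at hx
    rw [toY_apply] at hy
    have he1 : cfst f (i+1) i rfl (cmk f (i+1) i rfl x (-y)) = x := cfst_mk _ _ _ _ _ _
    have hde : (Cone f).d (i+1) i (cmk f (i+1) i rfl x (-y)) = c := by
      apply cext f i (i-1) (by ring)
      · rw [cfst_d f (i+1) i (i-1) rfl (by ring), cfst_mk]
        exact neg_eq_of_add_eq_zero_right hx
      · rw [csnd_d f (i+1) i rfl, cfst_mk, csnd_mk, map_neg, hy]; abel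
    generalize cmk f (i+1) i rfl x (-y) = e at he1 hde
    have hc0 : i ≤ m → (c : (Cone f).X i) = 0 := fun h => c.2.1 (Or.inl h)
    rcases le_or_gt m i with hi | hi
    · have heS : e ∈ S f m n (i + 1) := by
        refine ⟨fun h => ?_, fun h => ?_⟩
        · exact hn _ (by omega) e
        · have : i + 1 - 1 = i := by ring
          rw [this, hde]
          exact hc0 (by omega)
      refine ⟨(0, ⟨e, heS⟩), W_ext f m _ _ ?_ ?_⟩
      · rw [Wd_fst f m n (i+1) i rfl, map_zero, zero_add]; exact he1
      · exact hde
    · have hc := hc0 hi.le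
      obtain ⟨e', he'⟩ := (exact_iff _ _).1 (hconn (i + 1) (by omega)) e (by
        have : i + 1 - 1 = i := by ring
        rw [this, hde, hc])
      refine ⟨(-cfst f (i+1+1) (i+1) rfl e', 0), W_ext f m _ _ ?_ ?_⟩
      · rw [Wd_fst f m n (i+1) i rfl, map_neg, ← cfst_d f (i+1+1) (i+1) i rfl rfl, he', he1]
        change x + cfst f (i+1) i rfl 0 = x
        simp
      · change (Cone f).d (i+1) i 0 = c
        rw [hc, map_zero]
  · intro i y hy
    have hd : (Cone f).d i (i-1) (cmk f i (i-1) (by ring) 0 (-y)) = 0 := by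
      apply cext f (i-1) (i-1-1) (by ring)
      · rw [cfst_d f i (i-1) (i-1-1) (by ring) (by ring), cfst_mk]; simp
      · rw [csnd_d f i (i-1) (by ring), cfst_mk, csnd_mk, map_neg, hy]; simp
    rcases lt_or_ge m i with hi | hi
    · refine ⟨(0, ⟨cmk f i (i-1) (by ring) 0 (-y), ?_, fun _ => hd⟩), 0, W_ext f m _ _ ?_ ?_, ?_⟩
      · intro h
        exact hn _ (by omega) _
      · rw [Wd_fst f m n i (i-1) (by ring), map_zero, zero_add]
        exact cfst_mk _ _ _ _ _ _
      · exact hd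
      · rw [toY_apply, csnd_mk]; simp
    · obtain ⟨e, he⟩ := (exact_iff _ _).1 (hconn i hi) _ hd
      have h1 := cfst_d f (i+1) i (i-1) rfl (by ring) e
      have h2 := csnd_d f (i+1) i rfl e
      rw [he, cfst_mk] at h1
      rw [he, csnd_mk] at h2
      refine ⟨(-cfst f (i+1) i rfl e, 0), csnd f (i+1) e, W_ext f m _ _ ?_ ?_, ?_⟩
      · rw [Wd_fst f m n i (i-1) (by ring), map_neg, ← h1]
        change 0 + cfst f i (i-1) _ 0 = 0
        simp
      · exact map_zero ((Cone f).d i (i-1)).hom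
      · rw [toY_apply, map_neg]
        change _ - csnd f i 0 = _
        rw [map_zero, sub_zero, neg_eq_iff_add_eq_zero]
        rw [neg_eq_iff_add_eq_zero] at h2
        rw [← h2]; abel

/-- second projection of `W` -/
noncomputable def sp (n i : ℤ) : (W f m n).X i ⟶ ModuleCat.of R (S f m n i) :=
  ModuleCat.ofHom (LinearMap.snd R _ _)

lemma sp_surj (n i : ℤ) : Function.Surjective (sp f m n i) := fun c => ⟨(0, c), rfl⟩

lemma S_zero {n i : ℤ} (h : i ≤ m ∨ n < i) (c : S f m n i) : c = 0 := Subtype.ext (c.2.1 h)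

lemma inc_inj (n i : ℤ) : Function.Injective ((inc f m n).f i) :=
  fun _ _ h => congrArg Prod.fst h

lemma inc_surj (i : ℤ) (h : i ≠ m + 1) : Function.Surjective ((inc f m (m + 1)).f i) := by
  rintro ⟨x, c⟩
  exact ⟨x, Prod.ext rfl (S_zero f m (by omega) c).symm⟩

lemma inc_ex (n i : ℤ) (w : (W f m n).X i) :
    sp f m n i w = 0 ↔ ∃ x, (inc f m n).f i x = w := by
  constructor
  · intro h
    exact ⟨w.1, Prod.ext rfl h.symm⟩
  · rintro ⟨x, rfl⟩
    rfl

lemma tr_inj {n n' : ℤ} (h : n ≤ n') (i : ℤ) : Function.Injective ((tr f m h).f i) :=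
  fun a b hab => W_ext f m a b
    (congrArg (fun w : (W f m n').X i => w.1) hab)
    (congrArg (fun w : (W f m n').X i => (w.2 : (Cone f).X i)) hab)

lemma tr_surj (n : ℤ) (h : n ≤ n + 1) (i : ℤ) (hi : i ≠ n + 1) :
    Function.Surjective ((tr f m h).f i) := by
  rintro ⟨x, c, hc⟩
  exact ⟨(x, ⟨c, fun h' => hc.1 (by omega), hc.2⟩), rfl⟩

lemma tr_ex (n : ℤ) (h : n ≤ n + 1) (w : (W f m (n + 1)).X (n + 1)) :
    sp f m (n + 1) (n + 1) w = 0 ↔ ∃ x, (tr f m h).f (n + 1) x = w := by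
  constructor
  · intro h
    exact ⟨(w.1, 0), Prod.ext rfl h.symm⟩
  · rintro ⟨⟨x, c⟩, rfl⟩
    refine Subtype.ext ?_
    exact c.2.1 (by omega)

end Wd

section FG2
variable {A : Type u} [Ring A] {X Y : ChainComplex (ModuleCat.{u} (Polynomial A)) ℤ} (f : X ⟶ Y)
  (m : ℤ)

/-- cycles of the cone -/
noncomputable def Zc (i : ℤ) : ModuleCat.{u} (Polynomial A) :=
  ModuleCat.of _ (LinearMap.ker ((Cone f).d i (i - 1)).hom)

lemma fg_cone (hXfg : ∀ i, FGProjOverA A (X.X i)) (hYfg : ∀ i, FGProjOverA A (Y.X i)) (i : ℤ) :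
    FGProjOverA A ((Cone f).X i) :=
  fg_prod (hXfg (i - 1)) (hYfg i) (cequiv f i (i - 1) (by ring))

lemma fg_Zc (hXfg : ∀ i, FGProjOverA A (X.X i)) (hYfg : ∀ i, FGProjOverA A (Y.X i))
    (hconn : ∀ q : ℤ, q ≤ m → IsZero ((Cone f).homology q))
    (h0 : ∀ i, i < 0 → ∀ c : (Cone f).X i, c = 0) (k : ℕ) :
    ∀ i : ℤ, i < k → i ≤ m + 1 → FGProjOverA A (Zc f i) := by
  induction k with
  | zero =>
    intro i hi _
    exact fg_of_zero fun c => Subtype.ext (h0 i (by simpa using hi) c.1)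
  | succ k ih =>
    intro i hi hm
    push_cast at hi
    have hN := ih (i - 1) (by omega) (by omega)
    refine fg_ker (fg_cone f hXfg hYfg i) hN (ModuleCat.ofHom (Submodule.subtype _))
      (ModuleCat.ofHom (LinearMap.codRestrict _ ((Cone f).d i (i - 1)).hom
        fun c => dd (Cone f) _ _ _ c)) Subtype.val_injective ?_ ?_
    · rintro ⟨c, hc⟩
      obtain ⟨e, he⟩ := (exact_iff _ _).1 (hconn (i - 1) (by omega)) c hc
      obtain ⟨j, rfl⟩ : ∃ j, j + 1 = i := ⟨i - 1, by ring⟩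
      have hj : j + 1 - 1 + 1 = j + 1 := by ring
      revert e
      rw [hj]
      intro e he
      exact ⟨e, Subtype.ext he⟩
    · intro c
      constructor
      · intro h
        exact ⟨⟨c, congrArg Subtype.val h⟩, rfl⟩
      · rintro ⟨c, rfl⟩
        exact Subtype.ext c.2

lemma fg_S (hXfg : ∀ i, FGProjOverA A (X.X i)) (hYfg : ∀ i, FGProjOverA A (Y.X i))
    (hconn : ∀ q : ℤ, q ≤ m → IsZero ((Cone f).homology q))
    (h0 : ∀ i, i < 0 → ∀ c : (Cone f).X i, c = 0) (n i : ℤ) :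
    FGProjOverA A (ModuleCat.of _ (S f m n i)) := by
  by_cases h : i ≤ m ∨ n < i
  · exact fg_of_zero fun c => S_zero f m h c
  · by_cases hi : i = m + 1
    · have hS : S f m n i = LinearMap.ker ((Cone f).d i (i - 1)).hom := by
        ext c
        exact ⟨fun hc => hc.2 hi.le, fun hc => ⟨fun h' => (h h').elim, fun _ => hc⟩⟩
      rw [hS]
      exact fg_Zc f m hXfg hYfg hconn h0 (i.toNat + 1) i (by omega) hi.le
    · have hS : S f m n i = ⊤ := by
        ext c
        exact ⟨fun hc => trivial, fun hc => ⟨fun h' => (h h').elim, fun h' => by omega⟩⟩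
      rw [hS]
      exact fg_equiv (fg_cone f hXfg hYfg i) Submodule.topEquiv

lemma fg_W (hXfg : ∀ i, FGProjOverA A (X.X i)) (hYfg : ∀ i, FGProjOverA A (Y.X i))
    (hconn : ∀ q : ℤ, q ≤ m → IsZero ((Cone f).homology q))
    (h0 : ∀ i, i < 0 → ∀ c : (Cone f).X i, c = 0) (n i : ℤ) :
    FGProjOverA A ((W f m n).X i) :=
  fg_prod (N := ModuleCat.of _ (S f m n i)) (hXfg i) (fg_S f m hXfg hYfg hconn h0 n i)
    (LinearEquiv.refl _ _)

/-- the sequence -/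
noncomputable def Zs : ℕ → ChainComplex (ModuleCat.{u} (Polynomial A)) ℤ
  | 0 => X
  | (j + 1) => W f m (m + j + 1)

lemma le_aux (j : ℕ) : m + (j : ℤ) + 1 ≤ m + ((j + 1 : ℕ) : ℤ) + 1 := by push_cast; omega

/-- the maps -/
noncomputable def φs : ∀ j, Zs f m j ⟶ Zs f m (j + 1)
  | 0 => inc f m _
  | (j + 1) => tr f m (le_aux m j)

lemma comp_s (j : ℕ) : compChain (Zs f m) (φs f m) (j + 1) = inc f m (m + j + 1) := by
  induction j with
  | zero => exact Category.id_comp _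
  | succ j ih =>
    rw [compChain, ih]
    exact inc_tr f m (le_aux m j)

end FG2
end Aux

/-- An `m`-connected `A[t]`-linear map `f : X ⟶ Y` of bounded nonnegatively
graded chain complexes of `A[t]`-modules whose terms are finitely generated projective over
`A` factors as `X = Z_m → Z_{m+1} → ⋯ → Z_n ≃ Y` through complexes of the same kind, where
`Z_n ⟶ Y` is a quasi-isomorphism and each `cone(Z_{q−1} → Z_q)` has homology concentrated
in degree `q`, where it is finitely generated projective as an `A`-module. -/
theorem stmt11 {A : Type u} [Ring A]
    (X Y : ChainComplex (ModuleCat.{u} (Polynomial A)) ℤ)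
    (hXb : ∃ b : ℤ, ∀ i, (i < 0 ∨ b < i) → IsZero (X.X i))
    (hYb : ∃ b : ℤ, ∀ i, (i < 0 ∨ b < i) → IsZero (Y.X i))
    (hXfg : ∀ i, FGProjOverA A (X.X i))
    (hYfg : ∀ i, FGProjOverA A (Y.X i))
    (m : ℤ) (f : X ⟶ Y)
    (hconn : ∀ q : ℤ, q ≤ m → IsZero ((Cone f).homology q)) :
    ∃ (N : ℕ) (Z : ℕ → ChainComplex (ModuleCat.{u} (Polynomial A)) ℤ) (hZ0 : Z 0 = X)
      (φ : ∀ j, Z j ⟶ Z (j + 1)) (g : Z N ⟶ Y),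
      (∀ j i, FGProjOverA A ((Z j).X i)) ∧
      QuasiIso g ∧
      eqToHom hZ0.symm ≫ compChain Z φ N ≫ g = f ∧
      ∀ j : ℕ, j < N →
        (∀ q : ℤ, q ≠ m + (j : ℤ) + 1 → IsZero ((Cone (φ j)).homology q)) ∧
        FGProjOverA A ((Cone (φ j)).homology (m + (j : ℤ) + 1)) := by
  classical
  obtain ⟨b, hb⟩ := hXb
  obtain ⟨b', hb'⟩ := hYb
  have zer : ∀ {M : ModuleCat.{u} (Polynomial A)}, IsZero M → ∀ x y : M, x = y := fun h x y => by
    have := ModuleCat.subsingleton_of_isZero h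
    exact Subsingleton.elim x y
  have hC : ∀ i, (i < 0 ∨ max b b' + 1 < i) → ∀ c : (Cone f).X i, c = 0 := fun i hi c =>
    Aux.cext f i (i - 1) (by ring) c 0 (zer (hb _ (by omega)) _ _) (zer (hb' _ (by omega)) _ _)
  have h0 : ∀ i, i < 0 → ∀ c : (Cone f).X i, c = 0 := fun i hi => hC i (Or.inl hi)
  let k : ℕ := (max b b' + 1 - m).toNat
  refine ⟨k + 1, Aux.Zs f m, rfl, Aux.φs f m, Aux.toY f m (m + k + 1), ?_, ?_, ?_, ?_⟩
  · rintro (_ | j) i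
    · exact hXfg i
    · exact Aux.fg_W f m hXfg hYfg hconn h0 _ i
  · exact Aux.toY_quasi f m _ (fun i hi => hC i (by omega)) hconn
  · rw [Aux.comp_s]
    exact (Category.id_comp _).trans (Aux.inc_toY f m _)
  · rintro (_ | j) -
    · have e : m + ((0 : ℕ) : ℤ) + 1 = m + 1 := by simp
      have key : (∀ q : ℤ, q ≠ m + 1 → IsZero ((Cone (Aux.inc f m (m + 1))).homology q)) ∧
          FGProjOverA A ((Cone (Aux.inc f m (m + 1))).homology (m + 1)) := by
        refine ⟨fun q hq => Aux.cone_zero _ (m + 1) q hq (Aux.inc_inj f m _) (Aux.inc_surj f m), ?_⟩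
        obtain ⟨eq⟩ := Aux.cone_q (Aux.inc f m (m + 1)) (m + 1) (Aux.inc_inj f m _)
          (Aux.inc_surj f m) (Aux.sp f m _ _) (Aux.sp_surj f m _ _) (Aux.inc_ex f m _ _)
        exact Aux.fg_equiv (Aux.fg_S f m hXfg hYfg hconn h0 _ _) eq
      change (∀ q : ℤ, q ≠ m + ((0 : ℕ) : ℤ) + 1 →
          IsZero ((Cone (Aux.inc f m (m + ((0 : ℕ) : ℤ) + 1))).homology q)) ∧
          FGProjOverA A ((Cone (Aux.inc f m (m + ((0 : ℕ) : ℤ) + 1))).homology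
            (m + ((0 : ℕ) : ℤ) + 1))
      rw [e]
      exact key
    · have key : ∀ (n n' : ℤ) (h : n ≤ n'), n' = n + 1 →
          (∀ q : ℤ, q ≠ n' → IsZero ((Cone (Aux.tr f m h)).homology q)) ∧
          FGProjOverA A ((Cone (Aux.tr f m h)).homology n') := by
        rintro n _ h rfl
        refine ⟨fun q hq => Aux.cone_zero _ (n + 1) q hq (Aux.tr_inj f m h)
          (Aux.tr_surj f m n h), ?_⟩
        obtain ⟨eq⟩ := Aux.cone_q (Aux.tr f m h) (n + 1) (Aux.tr_inj f m h)
          (Aux.tr_surj f m n h) (Aux.sp f m _ _) (Aux.sp_surj f m _ _) (Aux.tr_ex f m n h)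
        exact Aux.fg_equiv (Aux.fg_S f m hXfg hYfg hconn h0 _ _) eq
      exact key _ _ (Aux.le_aux m j) (by push_cast; ring)
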